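/- Let p be an odd prime, let a ∈ Z/pZ be a non-square (not a quadratic residue), let F be a field that is an algebra over Z/pZ, and let α ∈ F satisfy α² = a (where a is viewed in F via the algebra map). Then for all i₁, j₁, i₂, j₂ ∈ Z/pZ, the element ((i₁ + α·j₁) − (i₂ + α·j₂))² lies in the image of Z/pZ in F if and only if i₁ = i₂ or j₁ = j₂. -/

import Mathlib

/-- Claim 6.2: with `α² = a` for a non-square `a ∈ ℤ/pℤ`, the square
`((i₁ + αj₁) - (i₂ + αj₂))²` lies in `ℤ/pℤ` iff `i₁ = i₂` or `j₁ = j₂`. -/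
theorem stmt17 (p : ℕ) (hp : p.Prime) (hodd : Odd p) (a : ZMod p)
    (ha : ¬ ∃ b : ZMod p, b ^ 2 = a)
    (F : Type*) [Field F] [Algebra (ZMod p) F]
    (α : F) (hα : α ^ 2 = algebraMap (ZMod p) F a)
    (i1 j1 i2 j2 : ZMod p) :
    ((algebraMap (ZMod p) F i1 + α * algebraMap (ZMod p) F j1) -
        (algebraMap (ZMod p) F i2 + α * algebraMap (ZMod p) F j2)) ^ 2 ∈
      Set.range (algebraMap (ZMod p) F) ↔ i1 = i2 ∨ j1 = j2 := by
  have : Fact p.Prime := ⟨hp⟩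
  have h2 : (2 : ZMod p) ≠ 0 := by
    have : Fact (2 < p) := ⟨hp.two_le.lt_of_ne (by rintro rfl; exact absurd hodd (by decide))⟩
    exact Ring.two_ne_zero (by rw [ZMod.ringChar_zmod_n]; exact this.out.ne')
  have hinj : Function.Injective (algebraMap (ZMod p) F) := (algebraMap (ZMod p) F).injective
  constructor
  · rintro ⟨c, hc⟩
    by_contra! hne
    have hx : i1 - i2 ≠ 0 := sub_ne_zero.2 hne.1
    have hy : j1 - j2 ≠ 0 := sub_ne_zero.2 hne.2
    set d : ZMod p := 2 * (i1 - i2) * (j1 - j2) with hd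
    have hd0 : d ≠ 0 := mul_ne_zero (mul_ne_zero h2 hx) hy
    set e : ZMod p := c - (i1 - i2) ^ 2 - a * (j1 - j2) ^ 2 with he
    have hα_mul : α * algebraMap (ZMod p) F d = algebraMap (ZMod p) F e := by
      simp only [hd, he, map_sub, map_mul, map_pow, map_ofNat, hc, ← hα]
      ring
    refine ha ⟨e / d, ?_⟩
    rw [div_pow, div_eq_iff (pow_ne_zero 2 hd0)]
    apply hinj
    rw [map_pow, ← hα_mul, mul_pow, hα, map_mul _ a, map_pow]
  · rintro (rfl | rfl)
    · refine ⟨a * (j1 - j2) ^ 2, ?_⟩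
      simp only [map_sub, map_mul, map_pow, ← hα]
      ring
    · refine ⟨(i1 - i2) ^ 2, ?_⟩
      simp only [map_sub, map_pow]
      ring
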